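/- arXiv:math/0602002 — 4 statements merged into one kernel-verified Lean document; each statement's English description precedes it below -/
import Mathlib

section
/- Let k ≥ 1 and let a₁ ≤ a₂ ≤ … ≤ a_k and b₁ ≤ b₂ ≤ … ≤ b_{k+2} be nondecreasing sequences of integers satisfying (1) Σᵢ aᵢ − Σⱼ bⱼ = −1, (2) Σᵢ aᵢ² − Σⱼ bⱼ² = 7, and (3) aᵢ ≥ b_{i+2} + 1 for all i = 1,…,k. Then 7 ≥ −(b₁² + b₂² − 2b₂(b₁ + b₂ − 2)) + 2b_{k+2} + k. -/
theorem key_estimate (k : ℕ) (hk : 1 ≤ k)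
    (a : Fin k → ℤ) (b : Fin (k + 2) → ℤ)
    (ha : Monotone a) (hb : Monotone b)
    (h1 : (∑ i, a i) - (∑ j, b j) = -1)
    (h2 : (∑ i, a i ^ 2) - (∑ j, b j ^ 2) = 7)
    (h3 : ∀ i : Fin k, a i ≥ b ⟨i.1 + 2, by omega⟩ + 1) :
    7 ≥ -(b ⟨0, by omega⟩ ^ 2 + b ⟨1, by omega⟩ ^ 2
        - 2 * b ⟨1, by omega⟩ * (b ⟨0, by omega⟩ + b ⟨1, by omega⟩ - 2))
      + 2 * b ⟨k + 1, by omega⟩ + (k : ℤ) := by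
  obtain ⟨n, rfl⟩ : ∃ n, k = n + 1 := ⟨k - 1, by omega⟩
  set p := b ⟨0, by omega⟩
  set q := b ⟨1, by omega⟩
  set c : Fin (n + 1) → ℤ := fun i => b ⟨i.1 + 2, by omega⟩
  have hqc : ∀ i, q ≤ c i := fun i => hb (by simp [Fin.le_def])
  have hac : ∀ i, c i + 1 ≤ a i := h3
  have hsum : ∑ j, b j = p + (q + ∑ i, c i) := by
    rw [Fin.sum_univ_succ, Fin.sum_univ_succ]; rfl
  have hsq : ∑ j, b j ^ 2 = p ^ 2 + (q ^ 2 + ∑ i, c i ^ 2) := by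
    rw [Fin.sum_univ_succ, Fin.sum_univ_succ]; rfl
  have hterm : ∀ i, 2 * q * (a i - c i) + 1 ≤ a i ^ 2 - c i ^ 2 := fun i => by
    nlinarith [mul_nonneg (sub_nonneg.2 (hqc i)) (sub_nonneg.2 (hac i)), hqc i, hac i]
  have hlast : 2 * q * (a (Fin.last n) - c (Fin.last n) - 1) + 2 * c (Fin.last n) + 1
      ≤ a (Fin.last n) ^ 2 - c (Fin.last n) ^ 2 := by
    nlinarith [mul_nonneg (sub_nonneg.2 (hqc (Fin.last n))) (sub_nonneg.2 (hac (Fin.last n))),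
      hac (Fin.last n)]
  have hinit := Finset.sum_le_sum fun (i : Fin n) (_ : i ∈ Finset.univ) => hterm i.castSucc
  simp only [Finset.sum_add_distrib, ← Finset.mul_sum, Finset.sum_sub_distrib, Finset.sum_const,
    Finset.card_univ, Fintype.card_fin, nsmul_eq_mul, mul_one] at hinit
  rw [hsum, Fin.sum_univ_castSucc, Fin.sum_univ_castSucc] at h1
  rw [hsq, Fin.sum_univ_castSucc, Fin.sum_univ_castSucc] at h2
  change 7 ≥ -(p ^ 2 + q ^ 2 - 2 * q * (p + q - 2)) + 2 * c (Fin.last n) + ((n + 1 : ℕ) : ℤ)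
  push_cast
  linear_combination hinit + hlast + h2 - 2 * q * h1
end

section
/- Let k ≥ 1 and let a₁ ≤ a₂ ≤ … ≤ a_k and b₁ ≤ b₂ ≤ … ≤ b_{k+2} be nondecreasing sequences of integers satisfying (1) Σᵢ aᵢ − Σⱼ bⱼ = −1, (2) Σᵢ aᵢ² − Σⱼ bⱼ² = 7, (3) aᵢ ≥ b_{i+2} + 1 for all i = 1,…,k, and (4) b₁ ≥ 0. Then 2b_{k+2} + k ≤ 11. -/
theorem condition_five (k : ℕ) (hk : 1 ≤ k)
    (a : Fin k → ℤ) (b : Fin (k + 2) → ℤ)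
    (ha : Monotone a) (hb : Monotone b)
    (h1 : (∑ i, a i) - (∑ j, b j) = -1)
    (h2 : (∑ i, a i ^ 2) - (∑ j, b j ^ 2) = 7)
    (h3 : ∀ i : Fin k, a i ≥ b ⟨i.1 + 2, by omega⟩ + 1)
    (h4 : 0 ≤ b ⟨0, by omega⟩) :
    2 * b ⟨k + 1, by omega⟩ + (k : ℤ) ≤ 11 := by
  rw [Fin.sum_univ_succ (n := k + 1), Fin.sum_univ_succ (n := k)] at h1 h2
  obtain ⟨x, hx⟩ : ∃ x, x = b 0 := ⟨_, rfl⟩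
  obtain ⟨y, hy⟩ : ∃ y, y = b (Fin.succ 0) := ⟨_, rfl⟩
  obtain ⟨c, hc⟩ : ∃ c : Fin k → ℤ, c = fun i => b i.succ.succ := ⟨_, rfl⟩
  have hx0 : 0 ≤ x := hx ▸ h4
  have hxy : x ≤ y := by
    rw [hx, hy]
    exact hb (Fin.zero_le _)
  have hyc (i : Fin k) : y ≤ c i := by
    rw [hy, hc]
    exact hb (Fin.succ_le_succ_iff.mpr (Fin.zero_le _))
  have hca (i : Fin k) : c i + 1 ≤ a i := by
    rw [hc]
    exact h3 i
  have hlast : b ⟨k + 1, by omega⟩ = c ⟨k - 1, by omega⟩ := by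
    rw [hc]
    congr 1
    ext
    simp
    omega
  have e1 : ∑ i, (a i - c i) = x + y - 1 := by
    rw [Finset.sum_sub_distrib, hc, hx, hy]
    linarith
  have e2 : ∑ i, (a i ^ 2 - c i ^ 2) = 7 + x ^ 2 + y ^ 2 := by
    rw [Finset.sum_sub_distrib, hc, hx, hy]
    linarith
  have hcard : (k : ℤ) ≤ ∑ i, (a i - c i) := by
    calc (k : ℤ) = ∑ _i : Fin k, (1 : ℤ) := by simp
      _ ≤ _ := Finset.sum_le_sum fun i _ => by linarith [hca i]
  have hsingle : c ⟨k - 1, by omega⟩ - y ≤ ∑ i, (c i - y) :=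
    Finset.single_le_sum (f := fun i => c i - y)
      (fun i _ => sub_nonneg.mpr (hyc i)) (Finset.mem_univ _)
  have hterm : (1 + 2 * y) * ∑ i, (a i - c i) + 2 * ∑ i, (c i - y)
      ≤ ∑ i, (a i ^ 2 - c i ^ 2) := by
    rw [Finset.mul_sum, Finset.mul_sum, ← Finset.sum_add_distrib]
    refine Finset.sum_le_sum fun i _ => ?_
    have hd : 0 ≤ a i - c i - 1 := by linarith [hca i]
    have he : 0 ≤ c i - y := sub_nonneg.mpr (hyc i)
    nlinarith [mul_nonneg hd he, mul_nonneg hd hd]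
  rw [e1, e2] at hterm
  rw [e1] at hcard
  rw [hlast]
  nlinarith [sq_nonneg (y - 2), mul_nonneg hx0 (sub_nonneg.mpr hxy),
    mul_nonneg hx0 (hx0.trans hxy)]
end

section
/- Let k ≥ 1 and let a₁ ≤ a₂ ≤ … ≤ a_k and b₁ ≤ b₂ ≤ … ≤ b_{k+2} be nondecreasing sequences of integers satisfying all six conditions: (1) Σᵢ aᵢ − Σⱼ bⱼ = −1; (2) Σᵢ aᵢ² − Σⱼ bⱼ² = 7; (3) aᵢ ≥ b_{i+2} + 1 for all i = 1,…,k; (4) b₁ ≥ 0; (5) 2b_{k+2} + k ≤ 11; (6) 2a_k + k ≤ 12. Then the pair ((a₁,…,a_k),(b₁,…,b_{k+2})) is one of the following six: ((5),(0,3,3)); ((4,5),(0,3,3,4)); ((5),(1,1,4)); ((3,4),(1,2,2,3)); ((4),(1,2,2)); ((3,3,3),(2,2,2,2,2)). -/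
/-- The linear relation and the gap conditions force the two smallest entries of `b` to be large. -/
lemma length_lt_sum_first_two (k : ℕ) (a : Fin k → ℤ) (b : Fin (k + 2) → ℤ)
    (hsum : (∑ i, a i) - (∑ j, b j) = -1)
    (hgap : ∀ i : Fin k, b i.succ.succ + 1 ≤ a i) :
    (k : ℤ) + 1 ≤ b 0 + b 1 := by
  have hle : ∑ i : Fin k, (b i.succ.succ + 1) ≤ ∑ i, a i :=
    Finset.sum_le_sum fun i _ => hgap i
  rw [Fin.sum_univ_succ, Fin.sum_univ_succ, Fin.succ_zero_eq_one] at hsum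
  simp only [Finset.sum_add_distrib, Finset.sum_const, Finset.card_univ, Fintype.card_fin,
    nsmul_eq_mul, mul_one] at hle
  linarith

/-- Together with the upper bound on the entries of `a`, the gap conditions leave only `k ≤ 4`. -/
lemma length_le_four (k : ℕ) (a : Fin k → ℤ) (b : Fin (k + 2) → ℤ) (hb : Monotone b)
    (hsum : (∑ i, a i) - (∑ j, b j) = -1)
    (hgap : ∀ i : Fin k, b i.succ.succ + 1 ≤ a i)
    (hbound : ∀ i, 2 * a i + (k : ℤ) ≤ 12) :
    k ≤ 4 := by
  cases k with
  | zero => omega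
  | succ n =>
    have hfirst := length_lt_sum_first_two (n + 1) a b hsum hgap
    have hlast := hgap (Fin.last n)
    have hmax := hbound (Fin.last n)
    have h01 : b 0 ≤ b 1 := hb (Fin.zero_le _)
    have hle : b 1 ≤ b (Fin.last n).succ.succ := hb (Fin.le_def.mpr (by simp))
    push_cast at hfirst hmax
    omega

theorem classification_of_pairs (k : ℕ) (hk : 1 ≤ k)
    (a : Fin k → ℤ) (b : Fin (k + 2) → ℤ)
    (ha : Monotone a) (hb : Monotone b)
    (h1 : (∑ i, a i) - (∑ j, b j) = -1)
    (h2 : (∑ i, a i ^ 2) - (∑ j, b j ^ 2) = 7)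
    (h3 : ∀ i : Fin k, a i ≥ b ⟨i.1 + 2, by omega⟩ + 1)
    (h4 : 0 ≤ b ⟨0, by omega⟩)
    (h5 : 2 * b ⟨k + 1, by omega⟩ + (k : ℤ) ≤ 11)
    (h6 : 2 * a ⟨k - 1, by omega⟩ + (k : ℤ) ≤ 12) :
    (List.ofFn a = [5] ∧ List.ofFn b = [0, 3, 3]) ∨
    (List.ofFn a = [4, 5] ∧ List.ofFn b = [0, 3, 3, 4]) ∨
    (List.ofFn a = [5] ∧ List.ofFn b = [1, 1, 4]) ∨
    (List.ofFn a = [3, 4] ∧ List.ofFn b = [1, 2, 2, 3]) ∨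
    (List.ofFn a = [4] ∧ List.ofFn b = [1, 2, 2]) ∨
    (List.ofFn a = [3, 3, 3] ∧ List.ofFn b = [2, 2, 2, 2, 2]) := by
  have hbound : ∀ i, 2 * a i + (k : ℤ) ≤ 12 := fun i => by
    have hle : a i ≤ a ⟨k - 1, by omega⟩ := ha (Fin.le_def.mpr (Nat.le_sub_one_of_lt i.isLt))
    linarith
  have hk4 := length_le_four k a b hb h1 h3 hbound
  have hsum := length_lt_sum_first_two k a b h1 h3
  obtain rfl | rfl | rfl | rfl : k = 1 ∨ k = 2 ∨ k = 3 ∨ k = 4 := by omega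
  all_goals
    clear hbound
    rw [Fin.monotone_iff_le_succ] at ha hb
    simp [Fin.forall_fin_succ, Fin.sum_univ_succ, List.ofFn_succ] at *
  · generalize a 0 = a₀ at *
    generalize b 0 = b₀ at *
    generalize b 1 = b₁ at *
    generalize b 2 = b₂ at *
    obtain ⟨_, _⟩ : 1 ≤ b₂ ∧ b₂ ≤ 4 := by omega
    obtain ⟨_, _⟩ : 1 ≤ b₁ ∧ b₁ ≤ 4 := by omega
    obtain ⟨_, _⟩ : 2 ≤ a₀ ∧ a₀ ≤ 5 := by omega
    obtain ⟨_, _⟩ : 0 ≤ b₀ ∧ b₀ ≤ 4 := by omega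
    (interval_cases b₂ <;> try omega) <;>
    (interval_cases b₁ <;> try omega) <;>
    (interval_cases a₀ <;> try omega) <;>
    (interval_cases b₀ <;> try omega)
  · generalize a 0 = a₀ at *
    generalize a 1 = a₁ at *
    generalize b 0 = b₀ at *
    generalize b 1 = b₁ at *
    generalize b 2 = b₂ at *
    generalize b 3 = b₃ at *
    obtain ⟨_, _⟩ : 2 ≤ b₃ ∧ b₃ ≤ 4 := by omega
    obtain ⟨_, _⟩ : 2 ≤ b₂ ∧ b₂ ≤ 4 := by omega
    obtain ⟨_, _⟩ : 2 ≤ b₁ ∧ b₁ ≤ 4 := by omega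
    obtain ⟨_, _⟩ : 3 ≤ a₀ ∧ a₀ ≤ 5 := by omega
    obtain ⟨_, _⟩ : 3 ≤ a₁ ∧ a₁ ≤ 5 := by omega
    obtain ⟨_, _⟩ : 0 ≤ b₀ ∧ b₀ ≤ 4 := by omega
    (interval_cases b₃ <;> try omega) <;>
    (interval_cases b₂ <;> try omega) <;>
    (interval_cases b₁ <;> try omega) <;>
    (interval_cases a₀ <;> try omega) <;>
    (interval_cases a₁ <;> try omega) <;>
    (interval_cases b₀ <;> try omega)
  · generalize a 0 = a₀ at *
    generalize a 1 = a₁ at *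
    generalize a 2 = a₂ at *
    generalize b 0 = b₀ at *
    generalize b 1 = b₁ at *
    generalize b 2 = b₂ at *
    generalize b 3 = b₃ at *
    generalize b 4 = b₄ at *
    obtain ⟨_, _⟩ : 2 ≤ b₄ ∧ b₄ ≤ 3 := by omega
    obtain ⟨_, _⟩ : 2 ≤ b₃ ∧ b₃ ≤ 3 := by omega
    obtain ⟨_, _⟩ : 2 ≤ b₂ ∧ b₂ ≤ 3 := by omega
    obtain ⟨_, _⟩ : 2 ≤ b₁ ∧ b₁ ≤ 3 := by omega
    obtain ⟨_, _⟩ : 3 ≤ a₀ ∧ a₀ ≤ 4 := by omega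
    obtain ⟨_, _⟩ : 3 ≤ a₁ ∧ a₁ ≤ 4 := by omega
    obtain ⟨_, _⟩ : 3 ≤ a₂ ∧ a₂ ≤ 4 := by omega
    obtain ⟨_, _⟩ : 0 ≤ b₀ ∧ b₀ ≤ 3 := by omega
    (interval_cases b₄ <;> try omega)
    (interval_cases b₃ <;> try omega) <;>
    (interval_cases b₂ <;> try omega) <;>
    (interval_cases b₁ <;> try omega) <;>
    (interval_cases a₀ <;> try omega) <;>
    (interval_cases a₁ <;> try omega) <;>
    (interval_cases a₂ <;> try omega) <;>
    (interval_cases b₀ <;> try omega)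
  · obtain ⟨hb₀, hb₁, hb₂, hb₃, hb₄, hb₅⟩ :
        b 0 = 2 ∧ b 1 = 3 ∧ b 2 = 3 ∧ b 3 = 3 ∧ b 4 = 3 ∧ b 5 = 3 := by omega
    obtain ⟨ha₀, ha₁, ha₂, ha₃⟩ : a 0 = 4 ∧ a 1 = 4 ∧ a 2 = 4 ∧ a 3 = 4 := by omega
    rw [ha₀, ha₁, ha₂, ha₃, hb₀, hb₁, hb₂, hb₃, hb₄, hb₅] at h2
    norm_num at h2
end

section
/- Let f = (f₀,…,f₄) and g = (g₀,…,g₄) be linearly independent vectors in ℂ⁵ with Plücker coordinates p_{ij} = f_i g_j − f_j g_i, and suppose the 5×5 complex matrix with rows f, g, (1,0,0,0,0), (0,0,1,1,0), (0,1,0,0,1) has rank at most 3. Then the 2×5 complex matrix with rows (p₂₃, p₃₄, −p₀₄, p₀₁, p₁₂) and (p₁₄, −p₀₂, −p₁₃, −p₂₄, p₀₃) has rank at most 1 if and only if p₀₁ · p₀₂ = p₁₂². -/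
/-- A minor of size larger than the rank of a matrix vanishes. -/
theorem Matrix.det_submatrix_eq_zero_of_rank_lt {m n l K : Type*} [Fintype n]
    [Fintype l] [DecidableEq l] [Field K] (A : Matrix m n K)
    (r : l → m) (c : l → n) (h : A.rank < Fintype.card l) : (A.submatrix r c).det = 0 := by
  by_contra hdet
  have hrank := Matrix.rank_of_isUnit _
    ((Matrix.isUnit_iff_isUnit_det _).2 (isUnit_iff_ne_zero.2 hdet))
  have hle := A.rank_submatrix_le r c
  omega

/-- If a matrix of rank at most `3` has `f` and the equations of the Horrocks–Mumford line `L₀,₀`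
among its rows, then `f` lies in the span of these equations. -/
theorem eq_of_rank_with_HM_line_le (f : Fin 5 → ℂ)
    {m : Type*} (A : Matrix m (Fin 5) ℂ) (r : Fin 4 → m)
    (hr : A.submatrix r id = Matrix.of ![f, ![1, 0, 0, 0, 0], ![0, 0, 1, 1, 0], ![0, 1, 0, 0, 1]])
    (hA : A.rank ≤ 3) : f 3 = f 2 ∧ f 4 = f 1 := by
  have key (c : Fin 4 → Fin 5) : (Matrix.submatrix (Matrix.of
      ![f, ![1, 0, 0, 0, 0], ![0, 0, 1, 1, 0], ![0, 1, 0, 0, 1]]) id c).det = 0 := by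
    rw [← hr, Matrix.submatrix_submatrix]
    exact A.det_submatrix_eq_zero_of_rank_lt _ _ (by simpa using Nat.lt_succ_of_le hA)
  have h₁ := key ![0, 1, 2, 3]
  have h₂ := key ![0, 1, 2, 4]
  simp [Matrix.det_succ_row_zero, Fin.sum_univ_succ, Fin.succAbove] at h₁ h₂
  constructor
  · linear_combination h₁
  · linear_combination h₂

theorem jumping_planes_through_HM_line (f g : Fin 5 → ℂ)
    (hfg : LinearIndependent ℂ ![f, g])
    (p : Fin 5 → Fin 5 → ℂ) (hp : ∀ i j, p i j = f i * g j - f j * g i)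
    (hcontain : Matrix.rank
        (Matrix.of ![f, g, ![1, 0, 0, 0, 0], ![0, 0, 1, 1, 0], ![0, 1, 0, 0, 1]]) ≤ 3) :
    (Matrix.rank (Matrix.of
        ![![p 2 3, p 3 4, -(p 0 4), p 0 1, p 1 2],
          ![p 1 4, -(p 0 2), -(p 1 3), -(p 2 4), p 0 3]]) ≤ 1) ↔
      p 0 1 * p 0 2 = p 1 2 ^ 2 := by
  obtain ⟨hf₃, hf₄⟩ := eq_of_rank_with_HM_line_le f _ ![0, 2, 3, 4]
    (by ext i j; fin_cases i <;> rfl) hcontain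
  obtain ⟨hg₃, hg₄⟩ := eq_of_rank_with_HM_line_le g _ ![1, 2, 3, 4]
    (by ext i j; fin_cases i <;> rfl) hcontain
  have h₂₃ : p 2 3 = 0 := by rw [hp, hf₃, hg₃]; ring
  have h₁₄ : p 1 4 = 0 := by rw [hp, hf₄, hg₄]; ring
  have h₃₄ : p 3 4 = -p 1 2 := by rw [hp, hp, hf₃, hg₃, hf₄, hg₄]; ring
  have h₂₄ : p 2 4 = -p 1 2 := by rw [hp, hp, hf₄, hg₄]; ring
  have h₀₄ : p 0 4 = p 0 1 := by rw [hp, hp, hf₄, hg₄]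
  have h₁₃ : p 1 3 = p 1 2 := by rw [hp, hp, hf₃, hg₃]
  have h₀₃ : p 0 3 = p 0 2 := by rw [hp, hp, hf₃, hg₃]
  rw [h₂₃, h₁₄, h₃₄, h₂₄, h₀₄, h₁₃, h₀₃]
  generalize p 0 1 = x
  generalize p 0 2 = y
  generalize p 1 2 = z
  constructor
  · intro h
    have hminor := Matrix.det_submatrix_eq_zero_of_rank_lt _ id ![3, 4]
      (h.trans_lt (by simp : 1 < Fintype.card (Fin 2)))
    simp [Matrix.det_fin_two] at hminor
    linear_combination hminor
  · intro h
    by_cases hx : x = 0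
    · have hz : z = 0 := pow_eq_zero_iff two_ne_zero |>.1 (by rw [← h, hx, zero_mul])
      convert Matrix.rank_vecMulVec_le ![0, 1] ![0, -y, 0, 0, y] using 2
      ext i j
      fin_cases i <;> fin_cases j <;> simp [Matrix.vecMulVec_apply, hx, hz]
    · have hy : y = z / x * z := by field_simp; linear_combination h
      have hxz : z = z / x * x := by field_simp
      convert Matrix.rank_vecMulVec_le ![1, z / x] ![0, -z, -x, x, z] using 2
      ext i j
      fin_cases i <;> fin_cases j <;> simp [Matrix.vecMulVec_apply, ← hxz, ← hy]
end
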